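/- If a two-dimensional complex Finsler metric on D is a complex Berwald metric, then δ_j I = 0 on D for all j. -/

import Mathlib

open Complex

noncomputable section

namespace CFinsler

/-- A point of `T'M` in local coordinates: `(z, η) ∈ ℂⁿ × ℂⁿ`. -/
abbrev Pt (n : ℕ) := (Fin n → ℂ) × (Fin n → ℂ)

variable {n : ℕ}

/-- Wirtinger derivative `∂f/∂z^k`. -/
def dz (f : Pt n → ℂ) (k : Fin n) (p : Pt n) : ℂ :=
  (1 / 2) * (fderiv ℝ f p ((Pi.single k 1 : Fin n → ℂ), 0) -
    Complex.I * fderiv ℝ f p ((Pi.single k Complex.I : Fin n → ℂ), 0))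

/-- Wirtinger derivative `∂f/∂z̄^k`. -/
def dzbar (f : Pt n → ℂ) (k : Fin n) (p : Pt n) : ℂ :=
  (1 / 2) * (fderiv ℝ f p ((Pi.single k 1 : Fin n → ℂ), 0) +
    Complex.I * fderiv ℝ f p ((Pi.single k Complex.I : Fin n → ℂ), 0))

/-- Wirtinger derivative `∂f/∂η^k`. -/
def de (f : Pt n → ℂ) (k : Fin n) (p : Pt n) : ℂ :=
  (1 / 2) * (fderiv ℝ f p (0, (Pi.single k 1 : Fin n → ℂ)) -
    Complex.I * fderiv ℝ f p (0, (Pi.single k Complex.I : Fin n → ℂ)))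

/-- Wirtinger derivative `∂f/∂η̄^k`. -/
def debar (f : Pt n → ℂ) (k : Fin n) (p : Pt n) : ℂ :=
  (1 / 2) * (fderiv ℝ f p (0, (Pi.single k 1 : Fin n → ℂ)) +
    Complex.I * fderiv ℝ f p (0, (Pi.single k Complex.I : Fin n → ℂ)))

/-- The fundamental metric tensor `g_{i j̄} := ∂²L/∂η^i ∂η̄^j`. -/
def gm (L : Pt n → ℂ) (i j : Fin n) : Pt n → ℂ := de (debar L j) i

/-- `L` is an `n`-dimensional complex Finsler metric on `D`. -/
structure IsCFM (n : ℕ) (D : Set (Pt n)) (L : Pt n → ℂ) : Prop where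
  openD : IsOpen D
  fiber_ne : ∀ p ∈ D, p.2 ≠ 0
  conic : ∀ p ∈ D, ∀ lam : ℂ, lam ≠ 0 → (p.1, lam • p.2) ∈ D
  smooth : ContDiffOn ℝ (⊤ : ℕ∞) L D
  real_im : ∀ p ∈ D, (L p).im = 0
  pos : ∀ p ∈ D, 0 < (L p).re
  homog : ∀ p ∈ D, ∀ lam : ℂ, lam ≠ 0 →
    L (p.1, lam • p.2) = ((Complex.normSq lam : ℝ) : ℂ) * L p
  hermitian : ∀ p ∈ D, ∀ i j, (starRingEnd ℂ) (gm L i j p) = gm L j i p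
  posdef : ∀ p ∈ D, ∀ v : Fin n → ℂ, v ≠ 0 →
    0 < (∑ i, ∑ j, gm L i j p * v i * (starRingEnd ℂ) (v j)).re

variable (L : Pt n → ℂ)

/-- The metric tensor as a matrix at a point. -/
def gmat (p : Pt n) : Matrix (Fin n) (Fin n) ℂ := fun i j => gm L i j p

/-- The inverse metric tensor `g^{l̄ i}`. -/
def gi (l i : Fin n) (p : Pt n) : ℂ := (gmat L p)⁻¹ l i

/-- The Chern–Finsler nonlinear connection coefficients
`N^i_k := g^{m̄ i} (∂g_{l m̄}/∂z^k) η^l`. -/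
def Nc (i k : Fin n) (p : Pt n) : ℂ :=
  ∑ m, ∑ l, gi L m i p * dz (gm L l m) k p * p.2 l

/-- The horizontal derivation `δ_k := ∂/∂z^k − N^j_k ∂/∂η^j`. -/
def del (f : Pt n → ℂ) (k : Fin n) (p : Pt n) : ℂ :=
  dz f k p - ∑ j, Nc L j k p * de f j p

/-- The conjugate horizontal derivation `δ_k̄ := ∂/∂z̄^k − N̄^j_k ∂/∂η̄^j`. -/
def delbar (f : Pt n → ℂ) (k : Fin n) (p : Pt n) : ℂ :=
  dzbar f k p - ∑ j, (starRingEnd ℂ) (Nc L j k p) * debar f j p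

/-- The horizontal Chern–Finsler connection coefficients `L^i_{jk} := g^{l̄ i} δ_k(g_{j l̄})`. -/
def Lc (i j k : Fin n) (p : Pt n) : ℂ := ∑ l, gi L l i p * del L (gm L j l) k p

/-- The vertical Chern–Finsler connection coefficients `C^i_{jk} := g^{l̄ i} ∂g_{j l̄}/∂η^k`. -/
def Cc (i j k : Fin n) (p : Pt n) : ℂ := ∑ l, gi L l i p * de (gm L j l) k p

/-- The spray coefficients `G^i := ½ N^i_j η^j`. -/
def Gs (i : Fin n) (p : Pt n) : ℂ := (1 / 2) * ∑ j, Nc L i j p * p.2 j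

/-- The canonical horizontal derivation `δ̊_k := ∂/∂z^k − (∂G^j/∂η^k) ∂/∂η^j`. -/
def delc (f : Pt n → ℂ) (k : Fin n) (p : Pt n) : ℂ :=
  dz f k p - ∑ j, de (Gs L j) k p * de f j p

/-- `F := √L`. -/
def Fh (p : Pt n) : ℂ := (Real.sqrt ((L p).re) : ℂ)

/-- `l^i := η^i / F`. -/
def lup (i : Fin n) (p : Pt n) : ℂ := p.2 i / Fh L p

/-- `l_i := g_{i j̄} η̄^j / F`. -/
def llow (i : Fin n) (p : Pt n) : ℂ :=
  (∑ j, gm L i j p * (starRingEnd ℂ) (p.2 j)) / Fh L p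

/-- `√g` where `g := det(g_{i j̄})`. -/
def sg (p : Pt n) : ℂ := (Real.sqrt ((gmat L p).det.re) : ℂ)

/-- The metric is Kähler. -/
def IsKahler (D : Set (Pt n)) : Prop := ∀ p ∈ D, ∀ i j k, Lc L i j k p = Lc L i k j p

/-- The metric is weakly Kähler. -/
def IsWeaklyKahler (D : Set (Pt n)) : Prop :=
  ∀ p ∈ D, ∀ k, (∑ i, ∑ j, ∑ l, gm L i l p * (Lc L i j k p - Lc L i k j p) *
    p.2 j * (starRingEnd ℂ) (p.2 l)) = 0

/-- The metric is purely Hermitian: `g_{i j̄}` does not depend on the fibre variable. -/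
def IsPurelyHermitian (D : Set (Pt n)) : Prop :=
  ∀ p ∈ D, ∀ i j k, de (gm L i j) k p = 0 ∧ debar (gm L i j) k p = 0

/-- The metric is a complex Berwald metric: Kähler with `L^i_{jk}` independent of the
fibre variable. -/
def IsBerwald (D : Set (Pt n)) : Prop :=
  IsKahler L D ∧ ∀ p ∈ D, ∀ i j k l, de (Lc L i j k) l p = 0 ∧ debar (Lc L i j k) l p = 0

/-- The metric is a complex Landsberg metric: the Berwald and Rund connections coincide. -/
def IsLandsberg (D : Set (Pt n)) : Prop :=
  ∀ p ∈ D, ∀ i j k, de (de (Gs L i) k) j p =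
    (1 / 2) * ∑ l, gi L l i p * (delc L (gm L j l) k p + delc L (gm L k l) j p)

/-- `m^i` of the local complex Berwald frame: `m¹ = −l₂/√g`, `m² = l₁/√g`. -/
def mup (L : Pt 2 → ℂ) (i : Fin 2) (p : Pt 2) : ℂ :=
  if i = 0 then -(llow L 1 p) / sg L p else llow L 0 p / sg L p

/-- `m_i := g_{i j̄} m̄^j`. -/
def mlow (L : Pt 2 → ℂ) (i : Fin 2) (p : Pt 2) : ℂ :=
  ∑ j, gm L i j p * (starRingEnd ℂ) (mup L j p)

/-- `A := m^j m^k l_h C^h_{kj}`. -/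
def sA (L : Pt 2 → ℂ) (p : Pt 2) : ℂ :=
  ∑ j, ∑ k, ∑ h, mup L j p * mup L k p * llow L h p * Cc L h k j p

/-- `B := m_h m^k m^j C^h_{jk}`. -/
def sB (L : Pt 2 → ℂ) (p : Pt 2) : ℂ :=
  ∑ j, ∑ k, ∑ h, mlow L h p * mup L k p * mup L j p * Cc L h j k p

/-- `J := l^j l^k l_i L^i_{jk}`. -/
def sJ (L : Pt 2 → ℂ) (p : Pt 2) : ℂ :=
  ∑ j, ∑ k, ∑ i, lup L j p * lup L k p * llow L i p * Lc L i j k p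

/-- `U := m^j l^k l_i L^i_{jk}`. -/
def sU (L : Pt 2 → ℂ) (p : Pt 2) : ℂ :=
  ∑ j, ∑ k, ∑ i, mup L j p * lup L k p * llow L i p * Lc L i j k p

/-- `V := l^j m^k l_i L^i_{jk}`. -/
def sV (L : Pt 2 → ℂ) (p : Pt 2) : ℂ :=
  ∑ j, ∑ k, ∑ i, lup L j p * mup L k p * llow L i p * Lc L i j k p

/-- `X := m^j m^k l_i L^i_{jk}`. -/
def sX (L : Pt 2 → ℂ) (p : Pt 2) : ℂ :=
  ∑ j, ∑ k, ∑ i, mup L j p * mup L k p * llow L i p * Lc L i j k p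

/-- `O := l^j l^k m_i L^i_{jk}`. -/
def sO (L : Pt 2 → ℂ) (p : Pt 2) : ℂ :=
  ∑ j, ∑ k, ∑ i, lup L j p * lup L k p * mlow L i p * Lc L i j k p

/-- `Y := m^j l^k m_i L^i_{jk}`. -/
def sY (L : Pt 2 → ℂ) (p : Pt 2) : ℂ :=
  ∑ j, ∑ k, ∑ i, mup L j p * lup L k p * mlow L i p * Lc L i j k p

/-- `E := l^j m^k m_i L^i_{jk}`. -/
def sE (L : Pt 2 → ℂ) (p : Pt 2) : ℂ :=
  ∑ j, ∑ k, ∑ i, lup L j p * mup L k p * mlow L i p * Lc L i j k p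

/-- `H := m^j m^k m_i L^i_{jk}`. -/
def sH (L : Pt 2 → ℂ) (p : Pt 2) : ℂ :=
  ∑ j, ∑ k, ∑ i, mup L j p * mup L k p * mlow L i p * Lc L i j k p

/-- The vertical curvature invariant `I := −(∂B/∂η̄^s) m̄^s − B B̄/2`. -/
def vI (L : Pt 2 → ℂ) (p : Pt 2) : ℂ :=
  -(∑ s, debar (sB L) s p * (starRingEnd ℂ) (mup L s p)) -
    sB L p * (starRingEnd ℂ) (sB L p) / 2

/-- The `v v̄`-Riemann type tensor `S_{r̄ j h̄ k} := −g_{i r̄} ∂C^i_{jk}/∂η̄^h`. -/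
def Sv (L : Pt 2 → ℂ) (r j h k : Fin 2) (p : Pt 2) : ℂ :=
  -∑ i, gm L i r p * debar (Cc L i j k) h p

/-- The `h h̄`-Riemann type tensor
`R_{r̄ j h̄ k} := g_{i r̄} (−δ_h̄(L^i_{jk}) − δ_h̄(N^l_k) C^i_{jl})`. -/
def Rh (L : Pt 2 → ℂ) (r j h k : Fin 2) (p : Pt 2) : ℂ :=
  ∑ i, gm L i r p *
    (-(delbar L (Lc L i j k) h p) - ∑ l, delbar L (Nc L l k) h p * Cc L i j l p)

/-- The horizontal curvature invariant `K := −(1/F) δ_k̄(J) η̄^k`. -/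
def hK (L : Pt 2 → ℂ) (p : Pt 2) : ℂ :=
  -(1 / Fh L p) * ∑ k, delbar L (sJ L) k p * (starRingEnd ℂ) (p.2 k)

/-- The horizontal curvature invariant
`W := −δ_s̄(H) m̄^s − ½ H (V̄+H̄) − B F δ_s̄(E) m̄^s`. -/
def hW (L : Pt 2 → ℂ) (p : Pt 2) : ℂ :=
  -(∑ s, delbar L (sH L) s p * (starRingEnd ℂ) (mup L s p)) -
    (1 / 2) * sH L p * ((starRingEnd ℂ) (sV L p) + (starRingEnd ℂ) (sH L p)) -
    sB L p * Fh L p * ∑ s, delbar L (sE L) s p * (starRingEnd ℂ) (mup L s p)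

/-- The weak symmetry condition `R_{0̄ k 0̄ 0} = R_{0̄ 0 0̄ k}`, i.e.
`R_{r̄ k h̄ s} η̄^r η̄^h η^s = R_{r̄ s h̄ k} η̄^r η^s η̄^h`. -/
def WeakSym (L : Pt 2 → ℂ) (D : Set (Pt 2)) : Prop :=
  ∀ p ∈ D, ∀ k,
    (∑ r, ∑ h, ∑ s, Rh L r k h s p * (starRingEnd ℂ) (p.2 r) *
      (starRingEnd ℂ) (p.2 h) * p.2 s) =
    ∑ r, ∑ s, ∑ h, Rh L r s h k p * (starRingEnd ℂ) (p.2 r) * p.2 s *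
      (starRingEnd ℂ) (p.2 h)


section Derivations

variable {E : Type*} [NormedAddCommGroup E] [NormedSpace ℝ E]

/-- The function `f` is real differentiable at `p`, and the first-order operator with symbol `Λ`
takes the value `d` on it there. -/
def HasD (Λ : (E →L[ℝ] ℂ) →ₗ[ℂ] ℂ) (f : E → ℂ) (p : E) (d : ℂ) : Prop :=
  ∃ f' : E →L[ℝ] ℂ, HasFDerivAt f f' p ∧ Λ f' = d

variable {Λ : (E →L[ℝ] ℂ) →ₗ[ℂ] ℂ} {f g : E → ℂ} {p : E} {a b : ℂ}

theorem HasD.eq (h : HasD Λ f p a) : Λ (fderiv ℝ f p) = a := by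
  obtain ⟨f', h, rfl⟩ := h
  rw [h.fderiv]

theorem hasD_of_differentiableAt (h : DifferentiableAt ℝ f p) : HasD Λ f p (Λ (fderiv ℝ f p)) :=
  ⟨_, h.hasFDerivAt, rfl⟩

theorem HasD.unique (h : HasD Λ f p a) (h' : HasD Λ f p b) : a = b := h.eq.symm.trans h'.eq

theorem HasD.of_eq (h : HasD Λ f p a) (hab : a = b) : HasD Λ f p b := hab ▸ h

theorem HasD.congr_of_eqOn {D : Set E} (h : HasD Λ f p a) (hD : IsOpen D) (hp : p ∈ D)
    (hfg : ∀ q ∈ D, g q = f q) : HasD Λ g p a := by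
  obtain ⟨f', h, rfl⟩ := h
  exact ⟨f', h.congr_of_eventuallyEq (Filter.eventuallyEq_of_mem (hD.mem_nhds hp) hfg), rfl⟩

theorem hasD_const (c : ℂ) : HasD Λ (fun _ => c) p 0 :=
  ⟨0, hasFDerivAt_const c p, map_zero Λ⟩

theorem HasD.add (hf : HasD Λ f p a) (hg : HasD Λ g p b) :
    HasD Λ (fun q => f q + g q) p (a + b) := by
  obtain ⟨f', hf, rfl⟩ := hf
  obtain ⟨g', hg, rfl⟩ := hg
  exact ⟨_, hf.fun_add hg, map_add Λ _ _⟩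

theorem HasD.neg (hf : HasD Λ f p a) : HasD Λ (fun q => -f q) p (-a) := by
  obtain ⟨f', hf, rfl⟩ := hf
  exact ⟨_, hf.fun_neg, map_neg Λ _⟩

theorem HasD.sub (hf : HasD Λ f p a) (hg : HasD Λ g p b) :
    HasD Λ (fun q => f q - g q) p (a - b) := by
  obtain ⟨f', hf, rfl⟩ := hf
  obtain ⟨g', hg, rfl⟩ := hg
  exact ⟨_, hf.fun_sub hg, map_sub Λ _ _⟩

theorem HasD.sum {ι : Type*} {s : Finset ι} {f : ι → E → ℂ} {a : ι → ℂ}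
    (hf : ∀ i ∈ s, HasD Λ (f i) p (a i)) :
    HasD Λ (fun q => ∑ i ∈ s, f i q) p (∑ i ∈ s, a i) := by
  classical
  induction s using Finset.induction_on with
  | empty => simpa using hasD_const 0
  | insert i s hi ih =>
    simp only [Finset.sum_insert hi]
    exact (hf i (Finset.mem_insert_self i s)).add
      (ih fun j hj => hf j (Finset.mem_insert_of_mem hj))

theorem HasD.mul (hf : HasD Λ f p a) (hg : HasD Λ g p b) :
    HasD Λ (fun q => f q * g q) p (a * g p + f p * b) := by
  obtain ⟨f', hf, rfl⟩ := hf
  obtain ⟨g', hg, rfl⟩ := hg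
  refine ⟨_, hf.mul hg, ?_⟩
  rw [map_add, map_smul, map_smul, smul_eq_mul, smul_eq_mul]
  ring

theorem HasD.div (hf : HasD Λ f p a) (hg : HasD Λ g p b) (h0 : g p ≠ 0) :
    HasD Λ (fun q => f q / g q) p (a / g p - f p * b / g p ^ 2) := by
  have hinv : HasD Λ (fun q => (g q)⁻¹) p (-b / g p ^ 2) := by
    obtain ⟨g', hg, rfl⟩ := hg
    refine ⟨(-(g p ^ 2)⁻¹) • g', ?_, ?_⟩
    · refine (((hasDerivAt_inv h0).hasFDerivAt.restrictScalars ℝ).comp p hg).congr_fderiv ?_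
      ext v
      simp [mul_comm]
    · rw [map_smul, smul_eq_mul]
      field_simp
  have h := hf.mul hinv
  simp only [← div_eq_mul_inv] at h
  convert h using 1
  ring

/-- The symbol `½ (∂_v + c ∂_w)` of a Wirtinger derivative. -/
def wirt (c : ℂ) (v w : E) : (E →L[ℝ] ℂ) →ₗ[ℂ] ℂ where
  toFun A := (1 / 2) * (A v + c * A w)
  map_add' A A' := by simp; ring
  map_smul' r A := by simp; ring

theorem contDiffOn_wirt {D : Set E} (hf : ContDiffOn ℝ (⊤ : ℕ∞) f D) (hD : IsOpen D)
    (c : ℂ) (v w : E) :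
    ContDiffOn ℝ (⊤ : ℕ∞) (fun q => wirt c v w (fderiv ℝ f q)) D := by
  have h : ContDiffOn ℝ (⊤ : ℕ∞) (fderiv ℝ f) D := hf.fderiv_of_isOpen hD (by simp)
  exact contDiffOn_const.mul ((h.clm_apply contDiffOn_const).add
    (contDiffOn_const.mul (h.clm_apply contDiffOn_const)))

theorem hasD_wirt_comm {D : Set E} (hf : ContDiffOn ℝ (⊤ : ℕ∞) f D) (hD : IsOpen D) (hp : p ∈ D)
    (c c' : ℂ) (v w v' w' : E) :
    HasD (wirt c v w) (fun q => wirt c' v' w' (fderiv ℝ f q)) p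
      (wirt c' v' w' (fderiv ℝ (fun q => wirt c v w (fderiv ℝ f q)) p)) := by
  have hfp : ContDiffAt ℝ (⊤ : ℕ∞) f p := hf.contDiffAt (hD.mem_nhds hp)
  have hs : IsSymmSndFDerivAt ℝ f p := hfp.isSymmSndFDerivAt (by
    rw [minSmoothness_of_isRCLikeNormedField]
    exact WithTop.coe_le_coe.2 (le_top (a := (2 : ℕ∞))))
  have h1 : DifferentiableAt ℝ (fderiv ℝ f) p :=
    (hfp.fderiv_right (m := 1)
      (WithTop.coe_le_coe.2 (le_top (a := (2 : ℕ∞))))).differentiableAt one_ne_zero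
  have hval (c : ℂ) (v w u : E) : fderiv ℝ (fun q => wirt c v w (fderiv ℝ f q)) p u =
      (1 / 2) * (fderiv ℝ (fderiv ℝ f) p u v + c * fderiv ℝ (fderiv ℝ f) p u w) := by
    have hv (v : E) : HasFDerivAt (fun q => fderiv ℝ f q v)
        ((fderiv ℝ (fderiv ℝ f) p).flip v) p := by
      simpa using h1.hasFDerivAt.clm_apply (hasFDerivAt_const v p)
    have := (((hv v).fun_add ((hv w).const_mul c)).const_mul (1 / 2 : ℂ)).fderiv
    change fderiv ℝ (fun q => (1 / 2 : ℂ) * (fderiv ℝ f q v + c * fderiv ℝ f q w)) p u = _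
    rw [this]
    simp
    ring
  have hd : DifferentiableAt ℝ (fun q => wirt c' v' w' (fderiv ℝ f q)) p :=
    ((contDiffOn_wirt hf hD c' v' w').contDiffAt (hD.mem_nhds hp)).differentiableAt (by simp)
  refine ⟨_, hd.hasFDerivAt, ?_⟩
  change (1 / 2 : ℂ) * (_ + c * _) = (1 / 2 : ℂ) * (_ + c' * _)
  rw [hval, hval, hval, hval, hs.eq v v', hs.eq w v', hs.eq v w', hs.eq w w']
  ring

theorem contDiffOn_div {D : Set E} (hf : ContDiffOn ℝ (⊤ : ℕ∞) f D)
    (hg : ContDiffOn ℝ (⊤ : ℕ∞) g D) (h0 : ∀ q ∈ D, g q ≠ 0) :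
    ContDiffOn ℝ (⊤ : ℕ∞) (fun q => f q / g q) D := by
  simp only [div_eq_mul_inv]
  exact hf.mul (hg.inv h0)

theorem contDiffOn_conj {D : Set E} (hf : ContDiffOn ℝ (⊤ : ℕ∞) f D) :
    ContDiffOn ℝ (⊤ : ℕ∞) (fun q => (starRingEnd ℂ) (f q)) D :=
  conjCLE.contDiff.comp_contDiffOn hf

theorem wirt_fderiv_conj (hf : DifferentiableAt ℝ f p) (c : ℂ) (v w : E) :
    wirt c v w (fderiv ℝ (fun q => (starRingEnd ℂ) (f q)) p) =
      (starRingEnd ℂ) (wirt ((starRingEnd ℂ) c) v w (fderiv ℝ f p)) := by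
  have h : HasFDerivAt (fun q => (starRingEnd ℂ) (f q))
      ((conjCLE : ℂ →L[ℝ] ℂ).comp (fderiv ℝ f p)) p :=
    conjCLE.hasFDerivAt.comp p hf.hasFDerivAt
  rw [h.fderiv]
  simp [wirt, map_ofNat]

end Derivations

section Operators

variable {D : Set (Pt n)} {f : Pt n → ℂ} {p : Pt n}

/-- The symbol of `∂/∂z^k`. -/
def dzSymbol (k : Fin n) : (Pt n →L[ℝ] ℂ) →ₗ[ℂ] ℂ :=
  wirt (-Complex.I) ((Pi.single k 1 : Fin n → ℂ), 0) ((Pi.single k Complex.I : Fin n → ℂ), 0)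

/-- The symbol of `∂/∂η^k`. -/
def deSymbol (k : Fin n) : (Pt n →L[ℝ] ℂ) →ₗ[ℂ] ℂ :=
  wirt (-Complex.I) (0, (Pi.single k 1 : Fin n → ℂ)) (0, (Pi.single k Complex.I : Fin n → ℂ))

/-- The symbol of `∂/∂η̄^k`. -/
def debarSymbol (k : Fin n) : (Pt n →L[ℝ] ℂ) →ₗ[ℂ] ℂ :=
  wirt Complex.I (0, (Pi.single k 1 : Fin n → ℂ)) (0, (Pi.single k Complex.I : Fin n → ℂ))

/-- The symbol of `δ_k` at `p`. -/
def delSymbol (L : Pt n → ℂ) (k : Fin n) (p : Pt n) : (Pt n →L[ℝ] ℂ) →ₗ[ℂ] ℂ :=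
  dzSymbol k - ∑ j, Nc L j k p • deSymbol j

theorem dz_eq (f : Pt n → ℂ) (k : Fin n) : dz f k = fun q => dzSymbol k (fderiv ℝ f q) := by
  funext q
  simp only [dz, dzSymbol, wirt, LinearMap.coe_mk, AddHom.coe_mk]
  ring

theorem de_eq (f : Pt n → ℂ) (k : Fin n) : de f k = fun q => deSymbol k (fderiv ℝ f q) := by
  funext q
  simp only [de, deSymbol, wirt, LinearMap.coe_mk, AddHom.coe_mk]
  ring

theorem debar_eq (f : Pt n → ℂ) (k : Fin n) :
    debar f k = fun q => debarSymbol k (fderiv ℝ f q) := rfl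

theorem delSymbol_apply (L : Pt n → ℂ) (k : Fin n) (p : Pt n) (A : Pt n →L[ℝ] ℂ) :
    delSymbol L k p A = dzSymbol k A - ∑ j, Nc L j k p * deSymbol j A := by
  simp [delSymbol]

theorem del_eq (L f : Pt n → ℂ) (k : Fin n) (p : Pt n) :
    del L f k p = delSymbol L k p (fderiv ℝ f p) := by
  simp only [del, delSymbol_apply, dz_eq, de_eq]

theorem contDiffOn_dz (hf : ContDiffOn ℝ (⊤ : ℕ∞) f D) (hD : IsOpen D) (k : Fin n) :
    ContDiffOn ℝ (⊤ : ℕ∞) (dz f k) D := by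
  rw [dz_eq]
  exact contDiffOn_wirt hf hD _ _ _

theorem contDiffOn_de (hf : ContDiffOn ℝ (⊤ : ℕ∞) f D) (hD : IsOpen D) (k : Fin n) :
    ContDiffOn ℝ (⊤ : ℕ∞) (de f k) D := by
  rw [de_eq]
  exact contDiffOn_wirt hf hD _ _ _

theorem contDiffOn_debar (hf : ContDiffOn ℝ (⊤ : ℕ∞) f D) (hD : IsOpen D) (k : Fin n) :
    ContDiffOn ℝ (⊤ : ℕ∞) (debar f k) D := by
  rw [debar_eq]
  exact contDiffOn_wirt hf hD _ _ _

theorem _root_.ContDiffOn.hasD (hf : ContDiffOn ℝ (⊤ : ℕ∞) f D) (hD : IsOpen D) (hp : p ∈ D)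
    (Λ : (Pt n →L[ℝ] ℂ) →ₗ[ℂ] ℂ) : HasD Λ f p (Λ (fderiv ℝ f p)) :=
  hasD_of_differentiableAt ((hf.contDiffAt (hD.mem_nhds hp)).differentiableAt (by simp))

/-- The commutator of `δ_k` with a constant-coefficient Wirtinger derivative. -/
theorem hasD_delSymbol_wirt (hf : ContDiffOn ℝ (⊤ : ℕ∞) f D) (hD : IsOpen D) (hp : p ∈ D)
    {L : Pt n → ℂ} {k : Fin n}
    (c : ℂ) (v w : Pt n) {a : ℂ} (ha : HasD (wirt c v w) (fun q => del L f k q) p a) {b : Fin n → ℂ}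
    (hb : ∀ j, HasD (wirt c v w) (Nc L j k) p (b j)) :
    HasD (delSymbol L k p) (fun q => wirt c v w (fderiv ℝ f q)) p (a + ∑ j, b j * de f j p) := by
  have h : HasD (wirt c v w) (fun q => del L f k q) p
      (wirt c v w (fderiv ℝ (dz f k) p) -
        ∑ j, (b j * de f j p + Nc L j k p * wirt c v w (fderiv ℝ (de f j) p))) :=
    ((contDiffOn_dz hf hD k).hasD hD hp _).sub
      (HasD.sum fun j _ => (hb j).mul ((contDiffOn_de hf hD j).hasD hD hp _))
  convert (contDiffOn_wirt hf hD c v w).hasD hD hp _ using 1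
  rw [ha.unique h, delSymbol_apply, dzSymbol, (hasD_wirt_comm hf hD hp ..).eq, dz_eq]
  have he (j : Fin n) : deSymbol j (fderiv ℝ (fun q => wirt c v w (fderiv ℝ f q)) p) =
      wirt c v w (fderiv ℝ (de f j) p) := by
    rw [deSymbol, (hasD_wirt_comm hf hD hp ..).eq, de_eq]
    rfl
  simp only [he, Finset.sum_add_distrib]
  simp only [dzSymbol]
  ring

theorem debar_conj (hf : DifferentiableAt ℝ f p) (k : Fin n) :
    debar (fun q => (starRingEnd ℂ) (f q)) k p = (starRingEnd ℂ) (de f k p) := by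
  rw [debar_eq, de_eq]
  simp only [debarSymbol, deSymbol]
  rw [wirt_fderiv_conj hf, conj_I]

theorem hasD_fiber (Λ : (Pt n →L[ℝ] ℂ) →ₗ[ℂ] ℂ) (p : Pt n) (i : Fin n) :
    HasD Λ (fun q => q.2 i) p (Λ (fderiv ℝ (fun q : Pt n => q.2 i) p)) :=
  hasD_of_differentiableAt (by fun_prop)

theorem fderiv_fiber (p v : Pt n) (i : Fin n) : fderiv ℝ (fun q : Pt n => q.2 i) p v = v.2 i := by
  have h := ((ContinuousLinearMap.proj (R := ℝ) (φ := fun _ : Fin n => ℂ) i).comp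
    (ContinuousLinearMap.snd ℝ (Fin n → ℂ) (Fin n → ℂ))).hasFDerivAt (x := p)
  exact DFunLike.congr_fun h.fderiv v

theorem fderiv_fiber_conj (p v : Pt n) (i : Fin n) :
    fderiv ℝ (fun q : Pt n => (starRingEnd ℂ) (q.2 i)) p v = (starRingEnd ℂ) (v.2 i) := by
  have h := ((conjCLE : ℂ →L[ℝ] ℂ).comp
    ((ContinuousLinearMap.proj (R := ℝ) (φ := fun _ : Fin n => ℂ) i).comp
      (ContinuousLinearMap.snd ℝ (Fin n → ℂ) (Fin n → ℂ)))).hasFDerivAt (x := p)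
  exact DFunLike.congr_fun h.fderiv v

theorem hasD_de_fiber (p : Pt n) (k i : Fin n) :
    HasD (deSymbol k) (fun q => q.2 i) p (if i = k then 1 else 0) := by
  convert hasD_fiber (deSymbol k) p i using 1
  simp only [deSymbol, wirt, LinearMap.coe_mk, AddHom.coe_mk, fderiv_fiber, Pi.single_apply]
  split_ifs
  · simp
    ring
  · simp

theorem hasD_debar_fiber (p : Pt n) (k i : Fin n) :
    HasD (debarSymbol k) (fun q => q.2 i) p 0 := by
  convert hasD_fiber (debarSymbol k) p i using 1
  simp only [debarSymbol, wirt, LinearMap.coe_mk, AddHom.coe_mk, fderiv_fiber, Pi.single_apply]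
  split_ifs <;> simp

theorem hasD_de_fiber_conj (p : Pt n) (k i : Fin n) :
    HasD (deSymbol k) (fun q => (starRingEnd ℂ) (q.2 i)) p 0 := by
  convert hasD_of_differentiableAt (Λ := deSymbol k)
    (f := fun q : Pt n => (starRingEnd ℂ) (q.2 i)) (p := p) (by fun_prop) using 1
  simp only [deSymbol, wirt, LinearMap.coe_mk, AddHom.coe_mk, fderiv_fiber_conj, Pi.single_apply]
  split_ifs <;> simp

theorem hasD_delSymbol_fiber (L : Pt n → ℂ) (p : Pt n) (k i : Fin n) :
    HasD (delSymbol L k p) (fun q => q.2 i) p (-Nc L i k p) := by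
  convert hasD_fiber (delSymbol L k p) p i using 1
  simp only [delSymbol_apply, (hasD_de_fiber p _ i).eq]
  simp [dzSymbol, wirt, fderiv_fiber]

theorem hasD_delSymbol_fiber_conj (L : Pt n → ℂ) (p : Pt n) (k i : Fin n) :
    HasD (delSymbol L k p) (fun q => (starRingEnd ℂ) (q.2 i)) p 0 := by
  convert hasD_of_differentiableAt (Λ := delSymbol L k p)
    (f := fun q : Pt n => (starRingEnd ℂ) (q.2 i)) (p := p) (by fun_prop) using 1
  simp only [delSymbol_apply, (hasD_de_fiber_conj p _ i).eq]
  simp [dzSymbol, wirt, fderiv_fiber_conj]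

theorem contDiff_fiber (i : Fin n) : ContDiff ℝ (⊤ : ℕ∞) (fun q : Pt n => q.2 i) :=
  (contDiff_apply ℝ ℂ i).comp contDiff_snd

end Operators

section Metric

variable {D : Set (Pt 2)} {L : Pt 2 → ℂ} {p : Pt 2}

theorem IsCFM.contDiffOn_gm (hL : IsCFM 2 D L) (i j : Fin 2) :
    ContDiffOn ℝ (⊤ : ℕ∞) (gm L i j) D :=
  contDiffOn_de (contDiffOn_debar hL.smooth hL.openD j) hL.openD i

theorem IsCFM.gm_self_re_pos (hL : IsCFM 2 D L) (hp : p ∈ D) : 0 < (gm L 0 0 p).re := by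
  have h := hL.posdef p hp (Pi.single 0 1) (by simp)
  simpa [Fin.sum_univ_two] using h

theorem IsCFM.det_im (hL : IsCFM 2 D L) (hp : p ∈ D) : (gmat L p).det.im = 0 := by
  rw [← conj_eq_iff_im, Matrix.det_fin_two]
  simp only [gmat, map_sub, map_mul, hL.hermitian p hp]
  ring

theorem IsCFM.det_re_pos (hL : IsCFM 2 D L) (hp : p ∈ D) : 0 < (gmat L p).det.re := by
  have h00 := hL.gm_self_re_pos hp
  have h := hL.posdef p hp ![-gm L 1 0 p, gm L 0 0 p] fun h => by
    have := congrFun h 1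
    simp only [Matrix.cons_val_one, Matrix.cons_val_fin_one, Pi.zero_apply] at this
    simp [this] at h00
  have he : ∑ i, ∑ j, gm L i j p * ![-gm L 1 0 p, gm L 0 0 p] i *
      (starRingEnd ℂ) (![-gm L 1 0 p, gm L 0 0 p] j) = (gmat L p).det * gm L 0 0 p := by
    simp only [Fin.sum_univ_two, Matrix.det_fin_two, gmat, Matrix.cons_val_zero,
      Matrix.cons_val_one, Matrix.cons_val_fin_one, map_neg, hL.hermitian p hp]
    ring
  rw [he, mul_re, hL.det_im hp, zero_mul, sub_zero] at h
  exact pos_of_mul_pos_left h h00.le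

theorem IsCFM.det_ne_zero (hL : IsCFM 2 D L) (hp : p ∈ D) : (gmat L p).det ≠ 0 := fun h => by
  have := hL.det_re_pos hp
  simp [h] at this

theorem IsCFM.sum_gi_mul_gm (hL : IsCFM 2 D L) (hp : p ∈ D) (l h : Fin 2) :
    ∑ i, gi L l i p * gm L i h p = if l = h then 1 else 0 := by
  have := congrFun₂ (Matrix.nonsing_inv_mul (gmat L p) (hL.det_ne_zero hp).isUnit) l h
  rwa [Matrix.mul_apply, Matrix.one_apply] at this

theorem IsCFM.contDiffOn_det (hL : IsCFM 2 D L) :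
    ContDiffOn ℝ (⊤ : ℕ∞) (fun q => (gmat L q).det) D := by
  simp only [Matrix.det_fin_two]
  exact ((hL.contDiffOn_gm 0 0).mul (hL.contDiffOn_gm 1 1)).sub
    ((hL.contDiffOn_gm 0 1).mul (hL.contDiffOn_gm 1 0))

theorem IsCFM.contDiffOn_gi (hL : IsCFM 2 D L) (l i : Fin 2) :
    ContDiffOn ℝ (⊤ : ℕ∞) (gi L l i) D := by
  have he : gi L l i = fun q => (gmat L q).det⁻¹ * (gmat L q).adjugate l i := by
    funext q
    simp [gi, Matrix.inv_def]
  rw [he]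
  refine (hL.contDiffOn_det.inv fun q hq => hL.det_ne_zero hq).mul ?_
  simp only [Matrix.adjugate_fin_two]
  fin_cases l <;> fin_cases i
  exacts [hL.contDiffOn_gm 1 1, (hL.contDiffOn_gm 0 1).neg, (hL.contDiffOn_gm 1 0).neg,
    hL.contDiffOn_gm 0 0]

theorem IsCFM.contDiffOn_Nc (hL : IsCFM 2 D L) (i k : Fin 2) :
    ContDiffOn ℝ (⊤ : ℕ∞) (Nc L i k) D :=
  ContDiffOn.sum fun m _ => ContDiffOn.sum fun l _ =>
    ((hL.contDiffOn_gi m i).mul (contDiffOn_dz (hL.contDiffOn_gm l m) hL.openD k)).mul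
      (contDiff_fiber l).contDiffOn

theorem IsCFM.contDiffOn_Lc (hL : IsCFM 2 D L) (i j k : Fin 2) :
    ContDiffOn ℝ (⊤ : ℕ∞) (Lc L i j k) D :=
  ContDiffOn.sum fun l _ => (hL.contDiffOn_gi l i).mul
    ((contDiffOn_dz (hL.contDiffOn_gm j l) hL.openD k).sub (ContDiffOn.sum fun m _ =>
      (hL.contDiffOn_Nc m k).mul (contDiffOn_de (hL.contDiffOn_gm j l) hL.openD m)))

theorem sum_mul_deSymbol (A : Pt 2 →L[ℝ] ℂ) (v : Fin 2 → ℂ) :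
    ∑ j, v j * deSymbol j A = (1 / 2) * (A (0, v) - Complex.I * A (0, Complex.I • v)) ∧
    ∑ j, (starRingEnd ℂ) (v j) * debarSymbol j A =
      (1 / 2) * (A (0, v) + Complex.I * A (0, Complex.I • v)) := by
  have hA (v : Fin 2 → ℂ) : A (0, v) =
      ∑ j, ((v j).re * A (0, Pi.single j 1) + (v j).im * A (0, Pi.single j Complex.I)) := by
    have hv : ((0, v) : Pt 2) = ∑ j, ((v j).re • ((0, Pi.single j 1) : Pt 2) +
        (v j).im • ((0, Pi.single j Complex.I) : Pt 2)) := by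
      rw [Fin.sum_univ_two]
      refine Prod.ext (by simp) (funext fun i => ?_)
      fin_cases i <;> simp [Complex.re_add_im]
    rw [hv]
    simp only [map_sum, map_add, map_smul, real_smul]
  rw [hA v, hA (Complex.I • v)]
  have h0 := re_add_im (v 0)
  have h1 := re_add_im (v 1)
  have hc (z : ℂ) : (starRingEnd ℂ) z = z.re - z.im * Complex.I := by
    apply Complex.ext <;> simp
  constructor
  · simp only [Fin.sum_univ_two, deSymbol, wirt, LinearMap.coe_mk, AddHom.coe_mk, Pi.smul_apply,
      smul_eq_mul, I_mul_re, I_mul_im, ofReal_neg]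
    linear_combination
      -(1 / 2) * (A (0, Pi.single 0 1) - Complex.I * A (0, Pi.single 0 Complex.I)) * h0 -
      (1 / 2) * (A (0, Pi.single 1 1) - Complex.I * A (0, Pi.single 1 Complex.I)) * h1 -
      (1 / 2) * ((v 0).im * A (0, Pi.single 0 Complex.I) +
        (v 1).im * A (0, Pi.single 1 Complex.I)) * I_sq
  · simp only [Fin.sum_univ_two, debarSymbol, wirt, LinearMap.coe_mk, AddHom.coe_mk, Pi.smul_apply,
      smul_eq_mul, I_mul_re, I_mul_im, ofReal_neg, hc]
    ring_nf
    simp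
    ring

theorem IsCFM.fderiv_fiber_smul (hL : IsCFM 2 D L) (hp : p ∈ D) (c : ℂ) :
    fderiv ℝ L p (0, c • p.2) = (c + (starRingEnd ℂ) c) * L p := by
  have hd : DifferentiableAt ℝ L p :=
    (hL.smooth.contDiffAt (hL.openD.mem_nhds hp)).differentiableAt (by simp)
  have h1 : HasDerivAt (fun t : ℝ => L (p + t • ((0, c • p.2) : Pt 2)))
      (fderiv ℝ L p (0, c • p.2)) 0 := hd.hasFDerivAt.hasLineDerivAt _
  have haff (c : ℂ) : HasDerivAt (fun t : ℝ => 1 + (t : ℂ) * c) c 0 := by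
    simpa using ((ofRealCLM.hasDerivAt (x := (0 : ℝ))).mul_const c).const_add 1
  have h2 : HasDerivAt (fun t : ℝ => (1 + (t : ℂ) * c) * (1 + (t : ℂ) * (starRingEnd ℂ) c) * L p)
      ((c + (starRingEnd ℂ) c) * L p) 0 := by
    simpa using ((haff c).fun_mul (haff _)).mul_const (L p)
  refine h1.unique (h2.congr_of_eventuallyEq ?_)
  have hne : ∀ᶠ t : ℝ in nhds 0, 1 + (t : ℂ) * c ≠ 0 :=
    (haff c).continuousAt.eventually_ne (by simp)
  filter_upwards [hne] with t ht
  have h := hL.homog p hp _ ht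
  rw [← mul_conj] at h
  simp only [map_add, map_one, map_mul, conj_ofReal] at h
  rw [← h]
  congr 1
  refine Prod.ext (by simp) (funext fun i => ?_)
  simp
  ring

theorem IsCFM.sum_fiber_mul_de (hL : IsCFM 2 D L) (hp : p ∈ D) :
    ∑ j, p.2 j * de L j p = L p := by
  have h := hL.fderiv_fiber_smul hp 1
  rw [one_smul] at h
  simp only [de_eq, (sum_mul_deSymbol _ _).1, h, hL.fderiv_fiber_smul hp, map_one, conj_I]
  ring

theorem IsCFM.sum_fiber_conj_mul_debar (hL : IsCFM 2 D L) (hp : p ∈ D) :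
    ∑ j, (starRingEnd ℂ) (p.2 j) * debar L j p = L p := by
  have h := hL.fderiv_fiber_smul hp 1
  rw [one_smul] at h
  simp only [debar_eq, (sum_mul_deSymbol _ _).2, h, hL.fderiv_fiber_smul hp, map_one, conj_I]
  ring

theorem IsCFM.gm_eq_debar_de (hL : IsCFM 2 D L) (hp : p ∈ D) (i j : Fin 2) :
    gm L i j p = debar (de L i) j p := by
  simp only [gm, de_eq, debar_eq, deSymbol, debarSymbol]
  exact (hasD_wirt_comm hL.smooth hL.openD hp ..).eq

theorem IsCFM.sum_gm_mul_fiber_conj (hL : IsCFM 2 D L) (hp : p ∈ D) (i : Fin 2) :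
    ∑ j, gm L i j p * (starRingEnd ℂ) (p.2 j) = de L i p := by
  have h : HasD (deSymbol i) (fun q => ∑ j, (starRingEnd ℂ) (q.2 j) * debar L j q) p _ :=
    HasD.sum fun j _ => (hasD_de_fiber_conj p i j).mul
      ((contDiffOn_debar hL.smooth hL.openD j).hasD hL.openD hp _)
  have h' := (hL.smooth.hasD hL.openD hp (deSymbol i)).congr_of_eqOn hL.openD hp
    fun q hq => hL.sum_fiber_conj_mul_debar hq
  simp only [de_eq L, ← h.unique h']
  simp only [gm, de_eq]
  exact Finset.sum_congr rfl fun j _ => by ring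

theorem IsCFM.sum_fiber_mul_gm (hL : IsCFM 2 D L) (hp : p ∈ D) (i : Fin 2) :
    ∑ j, p.2 j * gm L j i p = debar L i p := by
  have h : HasD (debarSymbol i) (fun q => ∑ j, q.2 j * de L j q) p _ :=
    HasD.sum fun j _ => (hasD_debar_fiber p i j).mul
      ((contDiffOn_de hL.smooth hL.openD j).hasD hL.openD hp _)
  have h' := (hL.smooth.hasD hL.openD hp (debarSymbol i)).congr_of_eqOn hL.openD hp
    fun q hq => hL.sum_fiber_mul_de hq
  simp only [debar_eq L, ← h.unique h']
  simp only [hL.gm_eq_debar_de hp, debar_eq]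
  exact Finset.sum_congr rfl fun j _ => by ring

theorem IsCFM.sum_fiber_mul_de_gm (hL : IsCFM 2 D L) (hp : p ∈ D) (i h : Fin 2) :
    ∑ j, p.2 j * de (gm L j i) h p = 0 := by
  have h1 : HasD (deSymbol h) (fun q => ∑ j, q.2 j * gm L j i q) p _ :=
    HasD.sum fun j _ => (hasD_de_fiber p h j).mul ((hL.contDiffOn_gm j i).hasD hL.openD hp _)
  have h2 := ((contDiffOn_debar hL.smooth hL.openD i).hasD hL.openD hp
    (deSymbol h)).congr_of_eqOn hL.openD hp fun q hq => hL.sum_fiber_mul_gm hq i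
  have h3 := h1.unique h2
  have h4 : deSymbol h (fderiv ℝ (debar L i) p) = gm L h i p := by rw [gm, de_eq]
  rw [Finset.sum_add_distrib, h4] at h3
  simp only [ite_mul, one_mul, zero_mul, Finset.sum_ite_eq', Finset.mem_univ, if_true] at h3
  simpa [de_eq] using h3

theorem IsCFM.eq_sum_gm (hL : IsCFM 2 D L) (hp : p ∈ D) :
    L p = ∑ i, p.2 i * ∑ j, gm L i j p * (starRingEnd ℂ) (p.2 j) := by
  simp only [hL.sum_gm_mul_fiber_conj hp, hL.sum_fiber_mul_de hp]

theorem IsCFM.Nc_eq (hL : IsCFM 2 D L) (hp : p ∈ D) (i k : Fin 2) :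
    Nc L i k p = ∑ s, Lc L i s k p * p.2 s := by
  have h (l h : Fin 2) := hL.sum_fiber_mul_de_gm hp l h
  rw [Nc]
  simp only [Lc, del, Fin.sum_univ_two] at h ⊢
  linear_combination gi L 0 i p * (Nc L 0 k p * h 0 0 + Nc L 1 k p * h 0 1) +
    gi L 1 i p * (Nc L 0 k p * h 1 0 + Nc L 1 k p * h 1 1)

theorem IsCFM.hasD_gm (hL : IsCFM 2 D L) (hp : p ∈ D) (i j k : Fin 2) :
    HasD (delSymbol L k p) (gm L i j) p (∑ h, Lc L h i k p * gm L h j p) := by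
  convert (hL.contDiffOn_gm i j).hasD hL.openD hp _ using 1
  rw [← del_eq]
  have h (l : Fin 2) := hL.sum_gi_mul_gm hp l j
  simp only [Lc, Fin.sum_univ_two] at h ⊢
  fin_cases j <;> simp at h ⊢ <;>
  linear_combination del L (gm L i 0) k p * h.1 + del L (gm L i 1) k p * h.2

end Metric

section Frame

variable {D : Set (Pt 2)} {L : Pt 2 → ℂ} {p : Pt 2}

/-- The trace `L^i_{ik}` of the horizontal connection coefficients. -/
def connTrace (L : Pt 2 → ℂ) (k : Fin 2) (p : Pt 2) : ℂ := ∑ i, Lc L i i k p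

theorem HasD.of_mul_self {E : Type*} [NormedAddCommGroup E] [NormedSpace ℝ E] {D : Set E}
    {Λ : (E →L[ℝ] ℂ) →ₗ[ℂ] ℂ} {f s : E → ℂ} {p : E} {a : ℂ} (hf : HasD Λ f p a)
    (hs : ContDiffOn ℝ (⊤ : ℕ∞) s D) (hD : IsOpen D) (hp : p ∈ D)
    (h : ∀ q ∈ D, s q * s q = f q) (h0 : s p ≠ 0) : HasD Λ s p (a / (2 * s p)) := by
  have hsd : HasD Λ s p _ :=
    hasD_of_differentiableAt ((hs.contDiffAt (hD.mem_nhds hp)).differentiableAt (by simp))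
  convert hsd using 1
  have he := (hf.congr_of_eqOn hD hp h).unique (hsd.mul hsd)
  rw [he]
  field_simp
  ring

theorem contDiffOn_sqrt_re {E : Type*} [NormedAddCommGroup E] [NormedSpace ℝ E] {D : Set E}
    {f : E → ℂ} (hf : ContDiffOn ℝ (⊤ : ℕ∞) f D) (h : ∀ q ∈ D, 0 < (f q).re) :
    ContDiffOn ℝ (⊤ : ℕ∞) (fun q => (Real.sqrt (f q).re : ℂ)) D :=
  ofRealCLM.contDiff.comp_contDiffOn
    ((reCLM.contDiff.comp_contDiffOn hf).sqrt fun q hq => (h q hq).ne')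

theorem sqrt_re_mul_self {z : ℂ} (h : 0 < z.re) (h' : z.im = 0) :
    (Real.sqrt z.re : ℂ) * (Real.sqrt z.re : ℂ) = z := by
  rw [← ofReal_mul, Real.mul_self_sqrt h.le]
  exact Complex.ext (by simp) (by simp [h'])

theorem IsCFM.contDiffOn_Fh (hL : IsCFM 2 D L) : ContDiffOn ℝ (⊤ : ℕ∞) (Fh L) D :=
  contDiffOn_sqrt_re hL.smooth hL.pos

theorem IsCFM.contDiffOn_sg (hL : IsCFM 2 D L) : ContDiffOn ℝ (⊤ : ℕ∞) (sg L) D :=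
  contDiffOn_sqrt_re hL.contDiffOn_det fun _ hq => hL.det_re_pos hq

theorem IsCFM.Fh_ne_zero (hL : IsCFM 2 D L) (hp : p ∈ D) : Fh L p ≠ 0 :=
  ofReal_ne_zero.2 (Real.sqrt_pos.2 (hL.pos p hp)).ne'

theorem IsCFM.sg_ne_zero (hL : IsCFM 2 D L) (hp : p ∈ D) : sg L p ≠ 0 :=
  ofReal_ne_zero.2 (Real.sqrt_pos.2 (hL.det_re_pos hp)).ne'

theorem contDiff_fiber_conj (i : Fin 2) :
    ContDiff ℝ (⊤ : ℕ∞) (fun q : Pt 2 => (starRingEnd ℂ) (q.2 i)) :=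
  conjCLE.contDiff.comp (contDiff_fiber i)

theorem IsCFM.contDiffOn_llow (hL : IsCFM 2 D L) (i : Fin 2) :
    ContDiffOn ℝ (⊤ : ℕ∞) (llow L i) D :=
  contDiffOn_div
    (ContDiffOn.sum fun j _ => (hL.contDiffOn_gm i j).mul (contDiff_fiber_conj j).contDiffOn)
    hL.contDiffOn_Fh fun _ hq => hL.Fh_ne_zero hq

theorem mup_zero (L : Pt 2 → ℂ) : mup L 0 = fun q => -llow L 1 q / sg L q := by
  funext q
  simp [mup]

theorem mup_one (L : Pt 2 → ℂ) : mup L 1 = fun q => llow L 0 q / sg L q := by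
  funext q
  simp [mup]

theorem IsCFM.contDiffOn_mup (hL : IsCFM 2 D L) (i : Fin 2) :
    ContDiffOn ℝ (⊤ : ℕ∞) (mup L i) D := by
  fin_cases i
  · simp only [Fin.zero_eta, mup_zero]
    exact contDiffOn_div (hL.contDiffOn_llow 1).neg hL.contDiffOn_sg fun _ hq => hL.sg_ne_zero hq
  · simp only [Fin.mk_one, mup_one]
    exact contDiffOn_div (hL.contDiffOn_llow 0) hL.contDiffOn_sg fun _ hq => hL.sg_ne_zero hq

theorem IsCFM.hasD_self (hL : IsCFM 2 D L) (hp : p ∈ D) (k : Fin 2) :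
    HasD (delSymbol L k p) L p 0 := by
  have h := (HasD.sum (s := Finset.univ) fun i _ => (hasD_delSymbol_fiber L p k i).mul
    (HasD.sum (s := Finset.univ) fun j _ =>
      (hL.hasD_gm hp i j k).mul (hasD_delSymbol_fiber_conj L p k j))).congr_of_eqOn
    hL.openD hp fun q hq => hL.eq_sum_gm hq
  convert h using 1
  simp only [hL.Nc_eq hp, Fin.sum_univ_two]
  ring

theorem IsCFM.hasD_Fh (hL : IsCFM 2 D L) (hp : p ∈ D) (k : Fin 2) :
    HasD (delSymbol L k p) (Fh L) p 0 := by
  simpa using (hL.hasD_self hp k).of_mul_self hL.contDiffOn_Fh hL.openD hp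
    (fun q hq => sqrt_re_mul_self (hL.pos q hq) (hL.real_im q hq)) (hL.Fh_ne_zero hp)

theorem IsCFM.hasD_sg (hL : IsCFM 2 D L) (hp : p ∈ D) (k : Fin 2) :
    HasD (delSymbol L k p) (sg L) p (1 / 2 * connTrace L k p * sg L p) := by
  have hg := hL.hasD_gm hp (k := k)
  have hdet : HasD (delSymbol L k p) (fun q => (gmat L q).det) p
      (connTrace L k p * (sg L p * sg L p)) := by
    have h := ((hg 0 0).mul (hg 1 1)).sub ((hg 0 1).mul (hg 1 0))
    have hs : sg L p * sg L p = (gmat L p).det := sqrt_re_mul_self (hL.det_re_pos hp) (hL.det_im hp)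
    rw [hs]
    simp only [Matrix.det_fin_two]
    refine h.of_eq ?_
    simp only [connTrace, Fin.sum_univ_two, gmat]
    ring
  convert hdet.of_mul_self hL.contDiffOn_sg hL.openD hp
    (fun q hq => sqrt_re_mul_self (hL.det_re_pos hq) (hL.det_im hq)) (hL.sg_ne_zero hp) using 1
  have := hL.sg_ne_zero hp
  field_simp

theorem IsCFM.hasD_llow (hL : IsCFM 2 D L) (hp : p ∈ D) (i k : Fin 2) :
    HasD (delSymbol L k p) (llow L i) p (∑ h, Lc L h i k p * llow L h p) := by
  have h := (HasD.sum (s := Finset.univ) fun j _ =>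
    (hL.hasD_gm hp i j k).mul (hasD_delSymbol_fiber_conj L p k j)).div
    (hL.hasD_Fh hp k) (hL.Fh_ne_zero hp)
  refine h.of_eq ?_
  simp only [llow, Fin.sum_univ_two]
  ring

theorem IsCFM.conj_llow (hL : IsCFM 2 D L) (hp : p ∈ D) (i : Fin 2) :
    (starRingEnd ℂ) (llow L i p) = (∑ j, gm L j i p * p.2 j) / Fh L p := by
  simp only [llow, Fh, map_div₀, map_sum, map_mul, conj_conj, conj_ofReal, hL.hermitian p hp]

theorem IsCFM.hasD_conj_llow (hL : IsCFM 2 D L) (hp : p ∈ D) (i k : Fin 2) :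
    HasD (delSymbol L k p) (fun q => (starRingEnd ℂ) (llow L i q)) p 0 := by
  have h := (HasD.sum (s := Finset.univ) fun j _ =>
    (hL.hasD_gm hp j i k).mul (hasD_delSymbol_fiber L p k j)).div
    (hL.hasD_Fh hp k) (hL.Fh_ne_zero hp)
  convert h.congr_of_eqOn hL.openD hp fun q hq => hL.conj_llow hq i using 1
  simp only [hL.Nc_eq hp, Fin.sum_univ_two]
  ring

theorem IsCFM.hasD_mup (hL : IsCFM 2 D L) (hp : p ∈ D) (i k : Fin 2) :
    HasD (delSymbol L k p) (mup L i) p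
      (1 / 2 * connTrace L k p * mup L i p - ∑ h, Lc L i h k p * mup L h p) := by
  have h0 := hL.sg_ne_zero hp
  fin_cases i
  · simp only [Fin.zero_eta, mup_zero, Fin.sum_univ_two, mup_one]
    convert (hL.hasD_llow hp 1 k).neg.div (hL.hasD_sg hp k) h0 using 1
    simp only [connTrace, Fin.sum_univ_two]
    field_simp
    ring
  · simp only [Fin.mk_one, mup_zero, Fin.sum_univ_two, mup_one]
    convert (hL.hasD_llow hp 0 k).div (hL.hasD_sg hp k) h0 using 1
    simp only [connTrace, Fin.sum_univ_two]
    field_simp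
    ring

theorem IsCFM.hasD_conj_mup (hL : IsCFM 2 D L) (hp : p ∈ D) (i k : Fin 2) :
    HasD (delSymbol L k p) (fun q => (starRingEnd ℂ) (mup L i q)) p
      (-(1 / 2) * connTrace L k p * (starRingEnd ℂ) (mup L i p)) := by
  have h0 := hL.sg_ne_zero hp
  have hs (q : Pt 2) : (starRingEnd ℂ) (sg L q) = sg L q := conj_ofReal _
  fin_cases i
  · simp only [Fin.zero_eta, mup_zero, map_div₀, map_neg, hs]
    convert (hL.hasD_conj_llow hp 1 k).neg.div (hL.hasD_sg hp k) h0 using 1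
    field_simp
    ring
  · simp only [Fin.mk_one, mup_one, map_div₀, hs]
    convert (hL.hasD_conj_llow hp 0 k).div (hL.hasD_sg hp k) h0 using 1
    field_simp
    ring

theorem IsCFM.sB_eq (hL : IsCFM 2 D L) (hp : p ∈ D) :
    sB L p = ∑ j, ∑ k, ∑ l, mup L j p * mup L k p * (starRingEnd ℂ) (mup L l p) *
      de (gm L j l) k p := by
  have h (l a : Fin 2) := hL.sum_gi_mul_gm hp l a
  refine Finset.sum_congr rfl fun j _ => Finset.sum_congr rfl fun k _ => ?_
  have h00 := h 0 0
  have h01 := h 0 1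
  have h10 := h 1 0
  have h11 := h 1 1
  simp only [Fin.sum_univ_two, mlow, Cc, reduceIte, zero_ne_one, one_ne_zero] at *
  linear_combination mup L j p * mup L k p *
    (de (gm L j 0) k p * ((starRingEnd ℂ) (mup L 0 p) * h00 + (starRingEnd ℂ) (mup L 1 p) * h01) +
    de (gm L j 1) k p * ((starRingEnd ℂ) (mup L 0 p) * h10 + (starRingEnd ℂ) (mup L 1 p) * h11))

theorem IsCFM.conj_de_gm (hL : IsCFM 2 D L) (hp : p ∈ D) (i j k : Fin 2) :
    (starRingEnd ℂ) (de (gm L i j) k p) = debar (gm L j i) k p := by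
  have hg := hL.contDiffOn_gm i j
  rw [← debar_conj ((hg.contDiffAt (hL.openD.mem_nhds hp)).differentiableAt (by simp))]
  exact ((contDiffOn_conj hg).hasD hL.openD hp (debarSymbol k)).unique
    (((hL.contDiffOn_gm j i).hasD hL.openD hp (debarSymbol k)).congr_of_eqOn hL.openD hp
      fun q hq => hL.hermitian q hq i j)

theorem IsCFM.conj_sB_eq (hL : IsCFM 2 D L) (hp : p ∈ D) :
    (starRingEnd ℂ) (sB L p) = ∑ j, ∑ k, ∑ l, (starRingEnd ℂ) (mup L j p) *
      (starRingEnd ℂ) (mup L k p) * mup L l p * debar (gm L l j) k p := by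
  simp only [hL.sB_eq hp, map_sum, map_mul, conj_conj, hL.conj_de_gm hp]

theorem IsCFM.contDiffOn_sB (hL : IsCFM 2 D L) : ContDiffOn ℝ (⊤ : ℕ∞) (sB L) D :=
  (ContDiffOn.sum fun j _ => ContDiffOn.sum fun k _ => ContDiffOn.sum fun l _ =>
    (((hL.contDiffOn_mup j).mul (hL.contDiffOn_mup k)).mul
      (contDiffOn_conj (hL.contDiffOn_mup l))).mul
      (contDiffOn_de (hL.contDiffOn_gm j l) hL.openD k)).congr fun _ hq => hL.sB_eq hq

end Frame

section Berwald

variable {D : Set (Pt 2)} {L : Pt 2 → ℂ} {p : Pt 2}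

theorem IsBerwald.hasD_de_Lc (hB : IsBerwald L D) (hL : IsCFM 2 D L) (hp : p ∈ D)
    (i j k l : Fin 2) : HasD (deSymbol l) (Lc L i j k) p 0 := by
  convert (hL.contDiffOn_Lc i j k).hasD hL.openD hp _ using 1
  rw [← (hB.2 p hp i j k l).1, de_eq]

theorem IsBerwald.hasD_debar_Lc (hB : IsBerwald L D) (hL : IsCFM 2 D L) (hp : p ∈ D)
    (i j k l : Fin 2) : HasD (debarSymbol l) (Lc L i j k) p 0 := by
  convert (hL.contDiffOn_Lc i j k).hasD hL.openD hp _ using 1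
  exact (hB.2 p hp i j k l).2.symm

theorem IsBerwald.hasD_de_Nc (hB : IsBerwald L D) (hL : IsCFM 2 D L) (hp : p ∈ D)
    (i k l : Fin 2) : HasD (deSymbol l) (Nc L i k) p (Lc L i l k p) := by
  have h := (HasD.sum (s := Finset.univ) fun s _ => (hB.hasD_de_Lc hL hp i s k l).mul
    (hasD_de_fiber p l s)).congr_of_eqOn hL.openD hp fun q hq => hL.Nc_eq hq i k
  simpa using h

theorem IsBerwald.hasD_debar_Nc (hB : IsBerwald L D) (hL : IsCFM 2 D L) (hp : p ∈ D)
    (i k l : Fin 2) : HasD (debarSymbol l) (Nc L i k) p 0 := by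
  have h := (HasD.sum (s := Finset.univ) fun s _ => (hB.hasD_debar_Lc hL hp i s k l).mul
    (hasD_debar_fiber p l s)).congr_of_eqOn hL.openD hp fun q hq => hL.Nc_eq hq i k
  simpa using h

theorem IsCFM.del_gm (hL : IsCFM 2 D L) (hp : p ∈ D) (i j k : Fin 2) :
    del L (gm L i j) k p = ∑ h, Lc L h i k p * gm L h j p := by
  rw [del_eq, (hL.hasD_gm hp i j k).eq]

theorem IsBerwald.hasD_de_gm (hB : IsBerwald L D) (hL : IsCFM 2 D L) (hp : p ∈ D)
    (i l j k : Fin 2) : HasD (delSymbol L k p) (de (gm L i l) j) p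
      (∑ h, Lc L h i k p * de (gm L h l) j p + ∑ h, Lc L h j k p * de (gm L i l) h p) := by
  have h := (HasD.sum (s := Finset.univ) fun h _ => (hB.hasD_de_Lc hL hp h i k j).mul
    ((hL.contDiffOn_gm h l).hasD hL.openD hp (deSymbol j))).congr_of_eqOn hL.openD hp
    fun q hq => hL.del_gm hq i l k
  have h' := hasD_delSymbol_wirt (hL.contDiffOn_gm i l) hL.openD hp _ _ _ h
    fun m => hB.hasD_de_Nc hL hp m k j
  rw [de_eq (gm L i l) j]
  exact h'.of_eq (by simp only [de_eq, zero_mul, zero_add])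

theorem IsBerwald.hasD_debar_gm (hB : IsBerwald L D) (hL : IsCFM 2 D L) (hp : p ∈ D)
    (i l j k : Fin 2) : HasD (delSymbol L k p) (debar (gm L i l) j) p
      (∑ h, Lc L h i k p * debar (gm L h l) j p) := by
  have h := (HasD.sum (s := Finset.univ) fun h _ => (hB.hasD_debar_Lc hL hp h i k j).mul
    ((hL.contDiffOn_gm h l).hasD hL.openD hp (debarSymbol j))).congr_of_eqOn hL.openD hp
    fun q hq => hL.del_gm hq i l k
  have h' := hasD_delSymbol_wirt (hL.contDiffOn_gm i l) hL.openD hp _ _ _ h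
    fun m => hB.hasD_debar_Nc hL hp m k j
  exact h'.of_eq (by simp only [debar_eq, zero_mul, zero_add, Finset.sum_const_zero, add_zero])

theorem IsBerwald.hasD_sB (hB : IsBerwald L D) (hL : IsCFM 2 D L) (hp : p ∈ D) (k : Fin 2) :
    HasD (delSymbol L k p) (sB L) p (1 / 2 * connTrace L k p * sB L p) := by
  have h := (HasD.sum (s := Finset.univ) fun j _ => HasD.sum (s := Finset.univ) fun m _ =>
    HasD.sum (s := Finset.univ) fun l _ =>
      (((hL.hasD_mup hp j k).mul (hL.hasD_mup hp m k)).mul (hL.hasD_conj_mup hp l k)).mul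
        (hB.hasD_de_gm hL hp j l m k)).congr_of_eqOn hL.openD hp fun q hq => hL.sB_eq hq
  convert h using 1
  simp only [hL.sB_eq hp, Fin.sum_univ_two]
  ring

theorem IsBerwald.hasD_conj_sB (hB : IsBerwald L D) (hL : IsCFM 2 D L) (hp : p ∈ D) (k : Fin 2) :
    HasD (delSymbol L k p) (fun q => (starRingEnd ℂ) (sB L q)) p
      (-(1 / 2) * connTrace L k p * (starRingEnd ℂ) (sB L p)) := by
  have h := (HasD.sum (s := Finset.univ) fun j _ => HasD.sum (s := Finset.univ) fun m _ =>
    HasD.sum (s := Finset.univ) fun l _ =>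
      (((hL.hasD_conj_mup hp j k).mul (hL.hasD_conj_mup hp m k)).mul (hL.hasD_mup hp l k)).mul
        (hB.hasD_debar_gm hL hp l j m k)).congr_of_eqOn hL.openD hp fun q hq => hL.conj_sB_eq hq
  convert h using 1
  simp only [hL.conj_sB_eq hp, Fin.sum_univ_two]
  ring

theorem IsBerwald.hasD_debar_sB (hB : IsBerwald L D) (hL : IsCFM 2 D L) (hp : p ∈ D)
    (s k : Fin 2) : HasD (delSymbol L k p) (debar (sB L) s) p
      (1 / 2 * connTrace L k p * debar (sB L) s p) := by
  have hc : HasD (debarSymbol s) (connTrace L k) p 0 :=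
    (HasD.sum (s := Finset.univ) fun i _ => hB.hasD_debar_Lc hL hp i i k s).of_eq (by simp)
  have h := (((hasD_const (1 / 2 : ℂ)).mul hc).mul
    (hL.contDiffOn_sB.hasD hL.openD hp (debarSymbol s))).congr_of_eqOn hL.openD hp
    fun q hq => (del_eq L (sB L) k q).trans (hB.hasD_sB hL hq k).eq
  have h' := hasD_delSymbol_wirt hL.contDiffOn_sB hL.openD hp _ _ _ h
    fun m => hB.hasD_debar_Nc hL hp m k s
  exact h'.of_eq (by
    simp only [debar_eq, zero_mul, mul_zero, zero_add, Finset.sum_const_zero, add_zero])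

end Berwald

/-- for a complex Berwald metric, `δ_j I = 0`. -/
theorem statement8 (D : Set (Pt 2)) (L : Pt 2 → ℂ) (hL : IsCFM 2 D L)
    (hB : IsBerwald L D) :
    ∀ p ∈ D, ∀ j, del L (vI L) j p = 0 := by
  intro p hp k
  have h := (HasD.sum (s := Finset.univ) fun s _ =>
    (hB.hasD_debar_sB hL hp s k).mul (hL.hasD_conj_mup hp s k)).neg.sub
    (((hB.hasD_sB hL hp k).mul (hB.hasD_conj_sB hL hp k)).div
      (hasD_const (2 : ℂ)) two_ne_zero)
  rw [del_eq]
  refine h.eq.trans ?_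
  simp only [Fin.sum_univ_two]
  ring

end CFinsler
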